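/- There exists ε > 0 such that if G is a uniformly random d-regular graph on n vertices with 2 < d < (1/5)·log n (and dn even), then with probability tending to 1 as n → ∞, stww(G) ≥ ε·(d/√(log n))·n^{(d−2)/(2d−2)}. -/

import Mathlib

noncomputable section

namespace TwwPaper

open Finset

variable {V : Type*}

/-- The number of edges of `G` with both endpoints in `X`. -/
def edgesIn (G : SimpleGraph V) (X : Finset V) : ℕ :=
  Nat.card {e : Sym2 V // e ∈ G.edgeSet ∧ ∀ v ∈ e, v ∈ X}

/-- The number of edges of `G`. -/
def edgeCount (G : SimpleGraph V) : ℕ := Nat.card G.edgeSet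

/-- The maximum average degree of `G`: the maximum over nonempty vertex subsets `X`
of `2 e(G[X]) / |X|`. -/
def mad [Fintype V] (G : SimpleGraph V) : ℝ :=
  ⨆ X : {X : Finset V // X.Nonempty}, (2 * edgesIn G X.1 : ℝ) / X.1.card

/-- The degree of a vertex. -/
def deg (G : SimpleGraph V) (v : V) : ℕ := Nat.card (G.neighborSet v)

/-- The maximum degree `Δ(G)`. -/
def maxDeg [Fintype V] (G : SimpleGraph V) : ℕ := univ.sup (deg G)

/-- `G` is `d`-regular. -/
def IsReg (G : SimpleGraph V) (d : ℕ) : Prop := ∀ v, deg G v = d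

/-- `G` admits an orientation with maximum outdegree at most one:
an assignment of a tail (source) vertex to each edge, no vertex being
the tail of two distinct edges. -/
def HasOrientationOutdegLEOne (G : SimpleGraph V) : Prop :=
  ∃ f : G.edgeSet → V, (∀ e : G.edgeSet, f e ∈ (e : Sym2 V)) ∧ Function.Injective f

/-- Two lists (sequences) of the same length `r` are close if they contain a common
subsequence of length `r - 1`, obtained by deleting one entry from each. -/
def Close {S : Type*} (L M : List S) : Prop :=
  ∃ i < L.length, ∃ j < M.length, L.eraseIdx i = M.eraseIdx j

section Partitions

variable [Fintype V] [DecidableEq V]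

/-- `Q` is obtained from `P` by merging the two distinct parts `A` and `B`. -/
def IsMergeStep (P Q : Finpartition (univ : Finset V)) : Prop :=
  ∃ A ∈ P.parts, ∃ B ∈ P.parts, A ≠ B ∧
    Q.parts = insert (A ∪ B) ((P.parts.erase A).erase B)

/-- Degree of the part `A` in the quotient graph `G / P`. -/
def quotDeg (G : SimpleGraph V) (P : Finpartition (univ : Finset V)) (A : Finset V) : ℕ :=
  Nat.card {B : Finset V // B ∈ P.parts ∧ B ≠ A ∧ ∃ u ∈ A, ∃ v ∈ B, G.Adj u v}

/-- Red degree of the part `A` with respect to the partition `P`: the number of other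
parts `B` which are neither fully adjacent nor fully non-adjacent to `A`. -/
def redDeg (G : SimpleGraph V) (P : Finpartition (univ : Finset V)) (A : Finset V) : ℕ :=
  Nat.card {B : Finset V // B ∈ P.parts ∧ B ≠ A ∧ (∃ u ∈ A, ∃ v ∈ B, G.Adj u v) ∧
    ¬ (∀ u ∈ A, ∀ v ∈ B, G.Adj u v)}

/-- There is a sequence of partitions of `V(G)`, starting at the discrete partition,
ending with at most one part, each obtained from the previous one by merging two parts,
such that every part of every intermediate partition has `degFn`-degree at most `w`. -/
def SeqOK (G : SimpleGraph V)
    (degFn : SimpleGraph V → Finpartition (univ : Finset V) → Finset V → ℕ) (w : ℕ) : Prop :=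
  ∃ n : ℕ, ∃ P : Fin (n + 1) → Finpartition (univ : Finset V),
    (∀ A ∈ (P 0).parts, A.card = 1) ∧
    (P (Fin.last n)).parts.card ≤ 1 ∧
    (∀ i : Fin n, IsMergeStep (P i.castSucc) (P i.succ)) ∧
    (∀ i, ∀ A ∈ (P i).parts, degFn G (P i) A ≤ w)

/-- The sparse twin-width of `G`: the least `w` such that `G` can be contracted to a
single vertex by iterated pairwise identifications with all intermediate (quotient)
graphs of maximum degree at most `w`. -/
def stww (G : SimpleGraph V) : ℕ := sInf {w | SeqOK G quotDeg w}

/-- The twin-width of `G`, via contraction sequences minimizing the maximum red degree. -/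
def tww (G : SimpleGraph V) : ℕ := sInf {w | SeqOK G redDeg w}

/-- The quotient graph `G / P`: parts of `P` are adjacent iff some edge of `G` joins them. -/
def quotGraph (G : SimpleGraph V) (P : Finpartition (univ : Finset V)) :
    SimpleGraph {A : Finset V // A ∈ P.parts} :=
  SimpleGraph.fromRel (fun A B => ∃ u ∈ A.1, ∃ v ∈ B.1, G.Adj u v)

end Partitions

/-- A graph is `w`-degenerate if every nonempty (induced) subgraph has a vertex of
degree at most `w` in it. -/
def Degenerate {W : Type*} (w : ℕ) (H : SimpleGraph W) : Prop :=
  ∀ s : Finset W, s.Nonempty → ∃ a ∈ s, Nat.card {b : W // b ∈ s ∧ H.Adj a b} ≤ w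

/-- The graph `Π(r₁,…,r_a; b, q)`: vertices are tuples `(v₁,…,v_a)` with `vᵢ ∈ [q]^{rᵢ}`,
two tuples being adjacent iff (they are distinct and) at least `b` coordinates are
pairwise equal or close. -/
def PiGraph (a b q : ℕ) (rfn : Fin a → ℕ) : SimpleGraph (∀ i : Fin a, Fin (rfn i) → Fin q) :=
  SimpleGraph.fromRel (fun u v => ∃ I : Finset (Fin a), I.card = b ∧
    ∀ i ∈ I, u i = v i ∨ Close (List.ofFn (u i)) (List.ofFn (v i)))

section Contraction

variable [Fintype V] [DecidableEq V]

/-- Merging two distinct parts of a finite partition gives a finite partition. -/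
theorem exists_isMergeStep (P : Finpartition (univ : Finset V)) (h : 1 < P.parts.card) :
    ∃ Q, IsMergeStep P Q ∧ Q.parts.card + 1 = P.parts.card := by
  obtain ⟨A, hA, B, hB, hAB⟩ := Finset.one_lt_card.mp h
  have hne : A ∪ B ∉ (P.parts.erase A).erase B := by
    intro hm
    have hm' : A ∪ B ∈ P.parts := mem_of_mem_erase (mem_of_mem_erase hm)
    obtain ⟨x, hx⟩ := P.nonempty_of_mem_parts hA
    have := P.eq_of_mem_parts hm' hA (mem_union_left _ hx) hx
    exact (mem_erase.mp (mem_of_mem_erase hm)).1 this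
  have hQ : ∃ Q : Finpartition (univ : Finset V),
      Q.parts = insert (A ∪ B) ((P.parts.erase A).erase B) := by
    refine ⟨Finpartition.ofExistsUnique (insert (A ∪ B) ((P.parts.erase A).erase B))
      (fun _ _ => subset_univ _) ?_ ?_, rfl⟩
    · intro x _
      obtain ⟨C, ⟨hC, hxC⟩, -⟩ := P.existsUnique_mem (mem_univ x)
      by_cases hx : x ∈ A ∪ B
      · refine ⟨A ∪ B, ⟨mem_insert_self _ _, hx⟩, ?_⟩
        rintro D ⟨hD, hxD⟩
        rcases mem_insert.mp hD with rfl | hD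
        · rfl
        · simp only [mem_erase] at hD
          rcases mem_union.mp hx with hx | hx
          · exact absurd (P.eq_of_mem_parts hD.2.2 hA hxD hx) hD.2.1
          · exact absurd (P.eq_of_mem_parts hD.2.2 hB hxD hx) hD.1
      · have hCA : C ≠ A := by rintro rfl; exact hx (mem_union_left _ hxC)
        have hCB : C ≠ B := by rintro rfl; exact hx (mem_union_right _ hxC)
        refine ⟨C, ⟨by simp [hC, hCA, hCB], hxC⟩, ?_⟩
        rintro D ⟨hD, hxD⟩
        rcases mem_insert.mp hD with rfl | hD
        · exact absurd hxD hx
        · simp only [mem_erase] at hD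
          exact P.eq_of_mem_parts hD.2.2 hC hxD hxC
    · intro h0
      rcases mem_insert.mp h0 with h0 | h0
      · obtain ⟨x, hx⟩ := P.nonempty_of_mem_parts hA
        have : x ∈ A ∪ B := mem_union_left _ hx
        rw [← h0] at this
        simp at this
      · exact P.bot_notMem (mem_of_mem_erase (mem_of_mem_erase h0))
  obtain ⟨Q, hQ⟩ := hQ
  refine ⟨Q, ⟨A, hA, B, hB, hAB, hQ⟩, ?_⟩
  rw [hQ, card_insert_of_notMem hne, card_erase_of_mem (mem_erase.mpr ⟨hAB.symm, hB⟩),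
    card_erase_of_mem hA]
  omega

theorem exists_seqOK (G : SimpleGraph V) : ∃ w, SeqOK G quotDeg w := by
  classical
  let next : Finpartition (univ : Finset V) → Finpartition (univ : Finset V) := fun P =>
    if h : 1 < P.parts.card then (exists_isMergeStep P h).choose else P
  have hnext : ∀ P : Finpartition (univ : Finset V), 1 < P.parts.card →
      IsMergeStep P (next P) ∧ (next P).parts.card + 1 = P.parts.card := by
    intro P h
    simp only [next, h, dif_pos]
    exact (exists_isMergeStep P h).choose_spec
  let R : ℕ → Finpartition (univ : Finset V) := fun i => next^[i] ⊥
  have hR : ∀ i, R (i + 1) = next (R i) := fun i => Function.iterate_succ_apply' _ _ _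
  set c := Fintype.card V with hc
  have hcard : ∀ i, i ≤ c - 1 → (R i).parts.card = c - i := by
    intro i
    induction i with
    | zero => intro _; simp [R, hc]
    | succ i ih =>
      intro hi
      have h1 := ih (by omega)
      have h2 := (hnext (R i) (by omega)).2
      rw [hR]
      omega
  refine ⟨Nat.card (Finset V), c - 1, fun i => R i, ?_, ?_, ?_, ?_⟩
  · intro A hA
    simp only [Fin.val_zero, R, Function.iterate_zero, id] at hA
    obtain ⟨x, -, rfl⟩ := Finpartition.mem_bot_iff.mp hA
    simp
  · have := hcard (c - 1) le_rfl
    simp only [Fin.val_last]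
    omega
  · intro i
    have hi := i.2
    have h1 := hcard i (by omega)
    have := (hnext (R i) (by omega)).1
    rw [← hR] at this
    simpa using this
  · intro i A _
    exact Nat.card_le_card_of_injective _ Subtype.val_injective

theorem seqOK_of_stww_le {G : SimpleGraph V} {w : ℕ} (h : stww G ≤ w) : SeqOK G quotDeg w := by
  have hm : stww G ∈ {w | SeqOK G quotDeg w} := Nat.sInf_mem (exists_seqOK G)
  obtain ⟨n, P, h0, h1, h2, h3⟩ := hm
  exact ⟨n, P, h0, h1, h2, fun i A hA => (h3 i A hA).trans h⟩

/-- Along a contraction sequence of width `w`, any set `U` meeting every part in fewer than `s`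
vertices splits into classes of size at most `2 * s`, constant on each part, whose quotient graph
has few edges. -/
theorem exists_balanced_classes (G : SimpleGraph V) {w s N : ℕ}
    (P : Fin (N + 1) → Finpartition (univ : Finset V))
    (hend : (P (Fin.last N)).parts.card ≤ 1)
    (hmerge : ∀ i : Fin N, IsMergeStep (P i.castSucc) (P i.succ))
    (hdeg : ∀ i, ∀ A ∈ (P i).parts, quotDeg G (P i) A ≤ w) (i : Fin (N + 1)) :
    ∀ U : Finset V, (∀ C ∈ (P i).parts, (C ∩ U).card < s) →
      ∃ (m : ℕ) (c : V → ℕ) (E : Finset (ℕ × ℕ)), m * s ≤ U.card + s ∧ (∀ v ∈ U, c v < m) ∧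
        E.card ≤ (w + 1) * m ∧ (∀ e ∈ E, e.1 < m ∧ e.2 < m) ∧
        (∀ j, (U.filter (fun v => c v = j)).card ≤ 2 * s) ∧
        (∀ C ∈ (P i).parts, ∀ u ∈ C ∩ U, ∀ v ∈ C ∩ U, c u = c v) ∧
        ∀ u ∈ U, ∀ v ∈ U, G.Adj u v → (c u, c v) ∈ E ∨ (c v, c u) ∈ E := by
  classical
  induction i using Fin.reverseInduction with
  | last =>
    intro U hU
    refine ⟨1, fun _ => 0, {(0, 0)}, by omega, by simp, by simp, by simp, ?_, by simp, by simp⟩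
    intro j
    have hsub : U ⊆ (P (Fin.last N)).parts.biUnion (fun C => C ∩ U) := by
      intro x hx
      obtain ⟨C, hC, hxC⟩ := (P (Fin.last N)).exists_mem (mem_univ x)
      exact mem_biUnion.mpr ⟨C, hC, mem_inter.mpr ⟨hxC, hx⟩⟩
    have h1 : U.card ≤ (P (Fin.last N)).parts.card * s :=
      (card_le_card hsub).trans (card_biUnion_le_card_mul _ _ _ fun C hC => (hU C hC).le)
    have h2 : (U.filter (fun _ => 0 = j)).card ≤ U.card := card_filter_le _ _
    nlinarith
  | cast i ih =>
    intro U hU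
    obtain ⟨A, hA, B, hB, hAB, hQ⟩ := hmerge i
    have hABmem : A ∪ B ∈ (P i.succ).parts := by rw [hQ]; exact mem_insert_self _ _
    have hcover : ∀ C ∈ (P i.castSucc).parts,
        C ∈ (P i.succ).parts ∨ C ⊆ A ∪ B := by
      intro C hC
      by_cases h1 : C = A
      · right; rw [h1]; exact subset_union_left
      by_cases h2 : C = B
      · right; rw [h2]; exact subset_union_right
      left; rw [hQ]; simp [hC, h1, h2]
    have hold : ∀ C ∈ (P i.succ).parts, C = A ∪ B ∨ C ∈ (P i.castSucc).parts := by
      intro C hC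
      rw [hQ] at hC
      simp only [mem_insert, mem_erase] at hC
      tauto
    by_cases hX : ((A ∪ B) ∩ U).card < s
    · obtain ⟨m, c, E, h1, h2, h3, h4, h5, h6, h7⟩ := ih U (by
        intro C hC
        rcases hold C hC with rfl | hC
        · exact hX
        · exact hU C hC)
      refine ⟨m, c, E, h1, h2, h3, h4, h5, ?_, h7⟩
      intro C hC u hu v hv
      rcases hcover C hC with h | h
      · exact h6 C h u hu v hv
      · exact h6 _ hABmem u (inter_subset_inter_right h hu) v (inter_subset_inter_right h hv)
    · push Not at hX
      set X := (A ∪ B) ∩ U with hXdef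
      have hXU : X ⊆ U := inter_subset_right
      have hXcard : X.card ≤ 2 * s := by
        have : X ⊆ (A ∩ U) ∪ (B ∩ U) := by rw [hXdef, union_inter_distrib_right]
        have h1 := card_le_card this
        have h2 := card_union_le (A ∩ U) (B ∩ U)
        have h3 := hU A hA
        have h4 := hU B hB
        omega
      obtain ⟨m, c, E, h1, h2, h3, h4, h5, h6, h7⟩ := ih (U \ X) (by
        intro C hC
        rcases hold C hC with rfl | hC
        · have : (A ∪ B) ∩ (U \ X) = ∅ := by
            ext x; simp [hXdef]
          rw [this, card_empty]
          have := hU A hA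
          omega
        · exact lt_of_le_of_lt (card_le_card (inter_subset_inter_left sdiff_subset)) (hU C hC))
      set J : Finset ℕ := ((U \ X).filter (fun v => ∃ u ∈ A ∪ B, G.Adj u v)).image c with hJ
      have hJm : ∀ j ∈ J, j < m := by
        intro j hj
        obtain ⟨v, hv, rfl⟩ := mem_image.mp hj
        exact h2 v (mem_filter.mp hv).1
      have hJcard : J.card ≤ w := by
        refine le_trans ?_ (hdeg i.succ (A ∪ B) hABmem)
        set T : Finset (Finset V) := univ.filter (fun D => D ∈ (P i.succ).parts ∧ D ≠ A ∪ B ∧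
          ∃ u ∈ A ∪ B, ∃ v ∈ D, G.Adj u v) with hT
        have hTq : quotDeg G (P i.succ) (A ∪ B) = T.card := by
          rw [quotDeg, Nat.card_eq_fintype_card, Fintype.card_subtype]
        rw [hTq]
        let g : Finset V → ℕ := fun D =>
          if h : (D ∩ (U \ X)).Nonempty then c h.choose else 0
        refine le_trans (card_le_card (?_ : J ⊆ T.image g)) card_image_le
        intro j hj
        obtain ⟨v, hv, rfl⟩ := mem_image.mp hj
        obtain ⟨hvU, u, hu, huv⟩ := mem_filter.mp hv
        obtain ⟨D, hD, hvD⟩ := (P i.succ).exists_mem (mem_univ v)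
        have hvD' : v ∈ D ∩ (U \ X) := mem_inter.mpr ⟨hvD, hvU⟩
        refine mem_image.mpr ⟨D, ?_, ?_⟩
        · simp only [hT, mem_filter, mem_univ, true_and]
          refine ⟨hD, ?_, u, hu, v, hvD, huv⟩
          rintro rfl
          simp only [hXdef, mem_sdiff, mem_inter] at hvU
          tauto
        · have hne : (D ∩ (U \ X)).Nonempty := ⟨v, hvD'⟩
          simp only [g, hne, dif_pos]
          exact h6 D hD _ hne.choose_spec v hvD'
      refine ⟨m + 1, fun v => if v ∈ X then m else c v,
        (E ∪ {(m, m)}) ∪ J.image (fun j => (m, j)), ?_, ?_, ?_, ?_, ?_, ?_, ?_⟩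
      · have := card_sdiff_add_card_eq_card hXU
        nlinarith
      · intro v hv
        by_cases hvX : v ∈ X
        · simp [hvX]
        · simp only [hvX, if_false]
          exact (h2 v (mem_sdiff.mpr ⟨hv, hvX⟩)).trans (Nat.lt_succ_self m)
      · have e1 := card_union_le (E ∪ {(m, m)}) (J.image (fun j => (m, j)))
        have e2 := card_union_le E {(m, m)}
        have e3 : (J.image (fun j => (m, j))).card ≤ J.card := card_image_le
        rw [card_singleton] at e2
        nlinarith
      · intro e he
        simp only [mem_union, mem_singleton, mem_image] at he
        rcases he with (he | rfl) | ⟨j, hj, rfl⟩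
        · have := h4 e he; omega
        · simp
        · have := hJm j hj; simp; omega
      · intro j
        by_cases hj : j = m
        · refine le_trans (card_le_card ?_) hXcard
          intro v hv
          obtain ⟨hvU, hv⟩ := mem_filter.mp hv
          by_contra hvX
          simp only [hvX, if_false] at hv
          have := h2 v (mem_sdiff.mpr ⟨hvU, hvX⟩)
          omega
        · refine le_trans (card_le_card ?_) (h5 j)
          intro v hv
          obtain ⟨hvU, hv⟩ := mem_filter.mp hv
          by_cases hvX : v ∈ X
          · simp only [hvX, if_true] at hv
            exact absurd hv.symm hj
          · simp only [hvX, if_false] at hv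
            exact mem_filter.mpr ⟨mem_sdiff.mpr ⟨hvU, hvX⟩, hv⟩
      · intro C hC u hu v hv
        obtain ⟨huC, huU⟩ := mem_inter.mp hu
        obtain ⟨hvC, hvU⟩ := mem_inter.mp hv
        rcases hcover C hC with h | h
        · by_cases hCe : C = A ∪ B
          · have e1 : u ∈ X := mem_inter.mpr ⟨hCe ▸ huC, huU⟩
            have e2 : v ∈ X := mem_inter.mpr ⟨hCe ▸ hvC, hvU⟩
            simp [e1, e2]
          · have key : ∀ x ∈ C, x ∉ X := fun x hx hxX =>
              hCe ((P i.succ).eq_of_mem_parts h hABmem hx (mem_inter.mp hxX).1)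
            have e1 := key u huC
            have e2 := key v hvC
            simp only [e1, e2, if_false]
            exact h6 C h u (mem_inter.mpr ⟨huC, mem_sdiff.mpr ⟨huU, e1⟩⟩) v
              (mem_inter.mpr ⟨hvC, mem_sdiff.mpr ⟨hvU, e2⟩⟩)
        · have e1 : u ∈ X := mem_inter.mpr ⟨h huC, huU⟩
          have e2 : v ∈ X := mem_inter.mpr ⟨h hvC, hvU⟩
          simp [e1, e2]
      · intro u hu v hv huv
        have hJmem : ∀ x ∈ X, ∀ y ∈ U, y ∉ X → G.Adj x y → c y ∈ J := fun x hx y hy hyX hxy =>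
          mem_image_of_mem _ (mem_filter.mpr
            ⟨mem_sdiff.mpr ⟨hy, hyX⟩, x, (mem_inter.mp hx).1, hxy⟩)
        by_cases huX : u ∈ X <;> by_cases hvX : v ∈ X
        · simp [huX, hvX]
        · left
          simp only [huX, hvX, if_true, if_false]
          exact mem_union_right _ (mem_image_of_mem _ (hJmem u huX v hv hvX huv))
        · right
          simp only [huX, hvX, if_true, if_false]
          exact mem_union_right _ (mem_image_of_mem _ (hJmem v hvX u hu huX huv.symm))
        · simp only [huX, hvX, if_false]
          have := h7 u (mem_sdiff.mpr ⟨hu, huX⟩) v (mem_sdiff.mpr ⟨hv, hvX⟩) huv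
          simp only [mem_union]
          tauto

end Contraction

section Counting

theorem deg_eq_degree (G : SimpleGraph V) (v : V) [Fintype (G.neighborSet v)] :
    deg G v = G.degree v := by
  rw [deg, Nat.card_eq_fintype_card, SimpleGraph.card_neighborSet_eq_degree]

theorem IsReg.two_mul_card_edgeFinset [Fintype V] {G : SimpleGraph V} [DecidableRel G.Adj] {d : ℕ}
    (h : IsReg G d) : 2 * G.edgeFinset.card = d * Fintype.card V := by
  rw [← SimpleGraph.sum_degrees_eq_twice_card_edges]
  simp_rw [← deg_eq_degree, h _]
  simp [mul_comm]

/-- The pairs of vertices allowed as edges by a coloring `c` and a set `E` of pairs of colors. -/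
def allowedPairs {n k : ℕ} (c : Fin n → Fin k) (E : Finset (Fin k × Fin k)) :
    Finset (Sym2 (Fin n)) :=
  (univ.filter (fun p : Fin n × Fin n => (c p.1, c p.2) ∈ E)).image (fun p => s(p.1, p.2))

theorem card_allowedPairs_le {n k b : ℕ} (c : Fin n → Fin k) (E : Finset (Fin k × Fin k))
    (hc : ∀ j, (univ.filter (fun v => c v = j)).card ≤ b) :
    (allowedPairs c E).card ≤ b ^ 2 * E.card := by
  refine card_image_le.trans ?_
  have hsub : (univ.filter (fun p : Fin n × Fin n => (c p.1, c p.2) ∈ E)) ⊆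
      E.biUnion (fun e => (univ.filter (fun v => c v = e.1)) ×ˢ
        (univ.filter (fun v => c v = e.2))) := by
    intro p hp
    exact mem_biUnion.mpr ⟨_, (mem_filter.mp hp).2, by simp⟩
  refine (card_le_card hsub).trans ?_
  rw [mul_comm]
  refine card_biUnion_le_card_mul _ _ _ fun e _ => ?_
  rw [card_product, sq]
  exact Nat.mul_le_mul (hc _) (hc _)

theorem exists_coloring_of_stww_le {n d w s k r : ℕ} (hs : 2 ≤ s) (hk : k = n / s + 1)
    (hwk : w + 1 ≤ k) (hr : d * n = 2 * r) {G : SimpleGraph (Fin n)} [DecidableRel G.Adj]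
    (hG : IsReg G d) (hw : stww G ≤ w) :
    ∃ c : Fin n → Fin k, (∀ j, (univ.filter (fun v => c v = j)).card ≤ 2 * s) ∧
      ∃ E ∈ powersetCard ((w + 1) * k) (univ : Finset (Fin k × Fin k)),
        G.edgeFinset ∈ powersetCard r (allowedPairs c E) := by
  obtain ⟨N, P, h0, h1, h2, h3⟩ := seqOK_of_stww_le hw
  obtain ⟨m, c, E, hm, hcm, hE, -, hcl, -, hadj⟩ :=
    exists_balanced_classes (s := s) G P h1 h2 h3 0 univ (by
      intro C hC
      rw [inter_univ, h0 C hC]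
      omega)
  simp only [mem_univ, true_imp_iff, card_univ, Fintype.card_fin] at hm hcm hadj
  have hmk : m ≤ k := by
    rw [hk, ← Nat.add_div_right n (by omega)]
    exact (Nat.le_div_iff_mul_le (by omega)).mpr hm
  let c' : Fin n → Fin k := fun v => ⟨c v, (hcm v).trans_le hmk⟩
  let E' : Finset (Fin k × Fin k) := univ.filter (fun p => ((p.1 : ℕ), (p.2 : ℕ)) ∈ E)
  have hE' : E'.card ≤ (w + 1) * k := by
    refine le_trans ?_ (hE.trans (Nat.mul_le_mul_left _ hmk))
    refine card_le_card_of_injOn (fun p => ((p.1 : ℕ), (p.2 : ℕ))) ?_ ?_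
    · intro p hp
      simpa [E'] using hp
    · rintro ⟨a, b⟩ - ⟨a', b'⟩ - h
      simp only [Prod.mk.injEq, Fin.val_inj] at h
      simp [h]
  obtain ⟨F, hEF, hF⟩ := exists_superset_card_eq hE' (by
    simpa using Nat.mul_le_mul_right k hwk)
  refine ⟨c', ?_, F, by simp [hF], ?_⟩
  · intro j
    refine le_trans (card_le_card ?_) (hcl j)
    intro v hv
    simp only [mem_filter, mem_univ, true_and] at hv ⊢
    rw [← hv]
  · rw [mem_powersetCard]
    refine ⟨?_, ?_⟩
    · intro e he
      induction e with | _ u v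
      have huv : G.Adj u v := by simpa using he
      rcases hadj u v huv with h | h
      · exact mem_image.mpr ⟨(u, v), by simpa using hEF (by simpa [E', c'] using h), rfl⟩
      · exact mem_image.mpr ⟨(v, u), by simpa using hEF (by simpa [E', c'] using h), Sym2.eq_swap⟩
    · have := hG.two_mul_card_edgeFinset
      rw [Fintype.card_fin] at this
      omega

theorem card_isReg_stww_le {n d w s k r : ℕ} (hs : 2 ≤ s) (hk : k = n / s + 1)
    (hwk : w + 1 ≤ k) (hr : d * n = 2 * r) :
    Nat.card {G : SimpleGraph (Fin n) // IsReg G d ∧ stww G ≤ w} ≤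
      k ^ n * ((k ^ 2).choose ((w + 1) * k) * ((2 * s) ^ 2 * ((w + 1) * k)).choose r) := by
  classical
  let T : Finset (Finset (Sym2 (Fin n))) :=
    (univ.filter (fun c : Fin n → Fin k =>
      ∀ j, (univ.filter (fun v => c v = j)).card ≤ 2 * s)).biUnion fun c =>
        (powersetCard ((w + 1) * k) (univ : Finset (Fin k × Fin k))).biUnion fun E =>
          powersetCard r (allowedPairs c E)
  have hT : T.card ≤
      k ^ n * ((k ^ 2).choose ((w + 1) * k) * ((2 * s) ^ 2 * ((w + 1) * k)).choose r) := by
    refine (card_biUnion_le_card_mul _ _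
      ((k ^ 2).choose ((w + 1) * k) * ((2 * s) ^ 2 * ((w + 1) * k)).choose r) ?_).trans ?_
    · intro c hc
      refine (card_biUnion_le_card_mul _ _ (((2 * s) ^ 2 * ((w + 1) * k)).choose r) ?_).trans ?_
      · intro E hE
        rw [card_powersetCard]
        refine Nat.choose_le_choose _ ?_
        rw [← (mem_powersetCard.mp hE).2]
        exact card_allowedPairs_le c E (mem_filter.mp hc).2
      · rw [card_powersetCard]
        simp [sq]
    · refine Nat.mul_le_mul_right _ ((card_filter_le _ _).trans ?_)
      simp
  refine le_trans ?_ hT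
  rw [Nat.card_eq_fintype_card, Fintype.card_subtype]
  refine card_le_card_of_injOn (fun G => G.edgeFinset) ?_ ?_
  · intro G hG
    obtain ⟨hG, hw⟩ := (mem_filter.mp hG).2
    obtain ⟨c, hc, E, hE, h⟩ := exists_coloring_of_stww_le hs hk hwk hr hG hw
    exact mem_biUnion.mpr ⟨c, by simpa using hc, mem_biUnion.mpr ⟨E, hE, h⟩⟩
  · intro G _ H _ h
    exact SimpleGraph.edgeFinset_inj.mp h

end Counting

section RegularGraphs

open SimpleGraph

/-- The graph obtained by replacing the edge `ab` by the two edges `au` and `bv`. -/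
def rewire (G : SimpleGraph V) (a b u v : V) : SimpleGraph V :=
  (G \ edge a b) ⊔ (edge a u ⊔ edge b v)

open Classical in
/-- Graphs in which `u` and `v` are non-adjacent of degree `i` and all other vertices have
degree `d`. -/
def almostReg [Fintype V] (d i : ℕ) (u v : V) : Finset (SimpleGraph V) :=
  univ.filter fun G => (∀ x, x ≠ u → x ≠ v → G.degree x = d) ∧ G.degree u = i ∧
    G.degree v = i ∧ ¬ G.Adj u v

open Classical in
/-- The pairs `(a, b)` along which `G` can be rewired. -/
def rewirable [Fintype V] (G : SimpleGraph V) (u v : V) : Finset (V × V) :=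
  univ.filter fun p => G.Adj p.1 p.2 ∧ p.1 ≠ u ∧ p.1 ≠ v ∧ p.2 ≠ u ∧ p.2 ≠ v ∧
    ¬ G.Adj p.1 u ∧ ¬ G.Adj p.2 v

theorem rewire_mem_almostReg [Fintype V] {d i : ℕ} {u v : V} (huv : u ≠ v) {G : SimpleGraph V}
    (hG : G ∈ almostReg d i u v) {a b : V} (hab : (a, b) ∈ rewirable G u v) :
    rewire G a b u v ∈ almostReg d (i + 1) u v := by
  classical
  simp only [almostReg, rewirable, mem_filter, mem_univ, true_and] at hG hab ⊢
  obtain ⟨hx, hu, hv, huv'⟩ := hG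
  obtain ⟨h, hau, hav, hbu, hbv, hnau, hnbv⟩ := hab
  have hne := h.ne
  have hba := h.symm
  have hadj : ∀ x y, (rewire G a b u v).Adj x y ↔
      (G.Adj x y ∧ ¬ ((x = a ∧ y = b ∨ x = b ∧ y = a) ∧ x ≠ y)) ∨
      ((x = a ∧ y = u ∨ x = u ∧ y = a) ∧ x ≠ y) ∨ ((x = b ∧ y = v ∨ x = v ∧ y = b) ∧ x ≠ y) := by
    intro x y
    simp only [rewire, sup_adj, sdiff_adj, edge_adj]
  have na : (rewire G a b u v).neighborFinset a = insert u ((G.neighborFinset a).erase b) := by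
    ext y
    simp only [mem_neighborFinset, hadj, mem_insert, mem_erase]
    grind
  have nb : (rewire G a b u v).neighborFinset b = insert v ((G.neighborFinset b).erase a) := by
    ext y
    simp only [mem_neighborFinset, hadj, mem_insert, mem_erase]
    grind
  have nu : (rewire G a b u v).neighborFinset u = insert a (G.neighborFinset u) := by
    ext y
    simp only [mem_neighborFinset, hadj, mem_insert]
    grind
  have nv : (rewire G a b u v).neighborFinset v = insert b (G.neighborFinset v) := by
    ext y
    simp only [mem_neighborFinset, hadj, mem_insert]
    grind
  have nx : ∀ x, x ≠ u → x ≠ v → x ≠ a → x ≠ b →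
      (rewire G a b u v).neighborFinset x = G.neighborFinset x := by
    intro x h1 h2 h3 h4
    ext y
    simp only [mem_neighborFinset, hadj]
    grind
  have swap : ∀ x y z : V, G.Adj x y → ¬ G.Adj x z →
      (insert z ((G.neighborFinset x).erase y)).card = G.degree x := by
    intro x y z hxy hxz
    rw [card_insert_of_notMem (by simp [hxz]), card_erase_of_mem (by simpa using hxy),
      card_neighborFinset_eq_degree]
    have : 0 < G.degree x := (G.degree_pos_iff_exists_adj x).mpr ⟨y, hxy⟩
    omega
  refine ⟨?_, ?_, ?_, ?_⟩
  · intro x h1 h2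
    by_cases h3 : x = a
    · subst h3
      rw [← card_neighborFinset_eq_degree, na, swap _ _ _ h hnau, hx _ h1 h2]
    by_cases h4 : x = b
    · subst h4
      rw [← card_neighborFinset_eq_degree, nb, swap _ _ _ hba hnbv, hx _ h1 h2]
    rw [← card_neighborFinset_eq_degree, nx x h1 h2 h3 h4, card_neighborFinset_eq_degree,
      hx x h1 h2]
  · rw [← card_neighborFinset_eq_degree, nu, card_insert_of_notMem (by
      simpa [G.adj_comm] using hnau), card_neighborFinset_eq_degree, hu]
  · rw [← card_neighborFinset_eq_degree, nv, card_insert_of_notMem (by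
      simpa [G.adj_comm] using hnbv), card_neighborFinset_eq_degree, hv]
  · rw [hadj]
    grind

theorem rewire_injective [Fintype V] {u v : V} {G H : SimpleGraph V} {a b : V}
    (hG : (a, b) ∈ rewirable G u v) (hH : (a, b) ∈ rewirable H u v)
    (h : rewire G a b u v = rewire H a b u v) : G = H := by
  classical
  simp only [rewirable, mem_filter, mem_univ, true_and] at hG hH
  ext x y
  have h1 : (rewire G a b u v).Adj x y ↔ (rewire H a b u v).Adj x y := by rw [h]
  simp only [rewire, sup_adj, sdiff_adj, edge_adj] at h1
  have e1 := hG.1.symm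
  have e2 := hH.1.symm
  have e3 := fun h => hG.2.2.2.2.2.1 (G.adj_symm h)
  have e4 := fun h => hH.2.2.2.2.2.1 (H.adj_symm h)
  have e5 := fun h => hG.2.2.2.2.2.2 (G.adj_symm h)
  have e6 := fun h => hH.2.2.2.2.2.2 (H.adj_symm h)
  have e7 := hG.1.ne
  by_cases hxy : x = y
  · subst hxy; simp
  grind

theorem card_rewirable [Fintype V] {d i n : ℕ} (hV : Fintype.card V = n + 2) {u v : V}
    (huv : u ≠ v) {G : SimpleGraph V} (hG : G ∈ almostReg d i u v) :
    d * n ≤ (rewirable G u v).card + 2 * i + 2 * (i * d) := by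
  classical
  simp only [almostReg, mem_filter, mem_univ, true_and] at hG
  obtain ⟨hx, hu, hv, huv'⟩ := hG
  have huv'' : ¬ G.Adj v u := fun h => huv' h.symm
  set S : Finset V := univ \ {u, v} with hS
  have hScard : S.card = n := by
    rw [hS, card_sdiff_of_subset (subset_univ _), card_univ, hV, card_pair huv]
    omega
  have hT : (S.sigma fun a => G.neighborFinset a).card = d * n := by
    rw [card_sigma, sum_congr rfl (g := fun _ => d), sum_const, hScard, smul_eq_mul, mul_comm]
    intro x hxS
    simp only [hS, mem_sdiff, mem_univ, true_and, mem_insert, mem_singleton, not_or] at hxS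
    rw [card_neighborFinset_eq_degree, hx x hxS.1 hxS.2]
  have hN : ∀ z, z = u ∨ z = v → ((G.neighborFinset z).sigma fun a => G.neighborFinset a).card
      = i * d := by
    intro z hz
    rw [card_sigma, sum_congr rfl (g := fun _ => d), sum_const, smul_eq_mul,
      card_neighborFinset_eq_degree]
    · rcases hz with rfl | rfl <;> simp [*]
    · intro x hxz
      rw [mem_neighborFinset] at hxz
      rw [card_neighborFinset_eq_degree]
      refine hx x ?_ ?_ <;> rintro rfl <;> rcases hz with rfl | rfl <;> simp_all
  have hsub : (S.sigma fun a => G.neighborFinset a).map (Equiv.sigmaEquivProd V V).toEmbedding ⊆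
      rewirable G u v ∪ (G.neighborFinset u ×ˢ {u} ∪ G.neighborFinset v ×ˢ {v} ∪
        (((G.neighborFinset u).sigma fun a => G.neighborFinset a).image fun p => (p.1, p.2)) ∪
        (((G.neighborFinset v).sigma fun a => G.neighborFinset a).image fun p => (p.2, p.1))) := by
    intro p hp
    obtain ⟨⟨a, b⟩, hab, rfl⟩ := mem_map.mp hp
    simp only [mem_sigma, hS, mem_sdiff, mem_univ, true_and, mem_insert, mem_singleton, not_or,
      mem_neighborFinset] at hab
    obtain ⟨⟨hau, hav⟩, hab⟩ := hab
    have hba := hab.symm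
    simp only [mem_union, mem_product, mem_image, mem_sigma, mem_neighborFinset, mem_singleton,
      rewirable, mem_filter, mem_univ, true_and, Equiv.coe_toEmbedding, Equiv.sigmaEquivProd_apply]
    by_cases h1 : b = u
    · subst h1; simp [hba]
    by_cases h2 : b = v
    · subst h2; simp [hba]
    by_cases h3 : G.Adj a u
    · right; left; right; exact ⟨⟨a, b⟩, ⟨h3.symm, hab⟩, rfl⟩
    by_cases h4 : G.Adj b v
    · right; right; exact ⟨⟨b, a⟩, ⟨h4.symm, hba⟩, rfl⟩
    left
    exact ⟨hab, hau, hav, h1, h2, h3, h4⟩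
  have key := card_le_card hsub
  rw [card_map, hT] at key
  have c0 := card_union_le (rewirable G u v) (G.neighborFinset u ×ˢ {u} ∪ G.neighborFinset v ×ˢ {v} ∪
        (((G.neighborFinset u).sigma fun a => G.neighborFinset a).image fun p => (p.1, p.2)) ∪
        (((G.neighborFinset v).sigma fun a => G.neighborFinset a).image fun p => (p.2, p.1)))
  have c1 := card_union_le (G.neighborFinset u ×ˢ {u} ∪ G.neighborFinset v ×ˢ {v} ∪
        (((G.neighborFinset u).sigma fun a => G.neighborFinset a).image fun p => (p.1, p.2)))
        (((G.neighborFinset v).sigma fun a => G.neighborFinset a).image fun p => (p.2, p.1))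
  have c2 := card_union_le (G.neighborFinset u ×ˢ {u} ∪ G.neighborFinset v ×ˢ {v})
        (((G.neighborFinset u).sigma fun a => G.neighborFinset a).image fun p => (p.1, p.2))
  have c3 := card_union_le (G.neighborFinset u ×ˢ {u}) (G.neighborFinset v ×ˢ {v})
  have d1 : (((G.neighborFinset u).sigma fun a => G.neighborFinset a).image
      fun p => (p.1, p.2)).card ≤ i * d := card_image_le.trans (hN u (Or.inl rfl)).le
  have d2 : (((G.neighborFinset v).sigma fun a => G.neighborFinset a).image
      fun p => (p.2, p.1)).card ≤ i * d := card_image_le.trans (hN v (Or.inr rfl)).le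
  rw [card_product, card_product, card_singleton, card_singleton, card_neighborFinset_eq_degree,
    card_neighborFinset_eq_degree, hu, hv] at c3
  omega

theorem card_almostReg_succ [Fintype V] {d i n : ℕ} (hV : Fintype.card V = n + 2) {u v : V}
    (huv : u ≠ v) (hi : i < d) (hn : 4 * d ≤ n) :
    (almostReg d i u v).card * (d * n) ≤ 2 * (i + 1) ^ 2 * (almostReg d (i + 1) u v).card := by
  classical
  have h1 : ∀ G ∈ almostReg d i u v, d * n ≤ 2 * (rewirable G u v).card := by
    intro G hG
    have := card_rewirable hV huv hG
    have h2 : i + i * d + 1 ≤ d * d := by nlinarith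
    have h3 : d * (4 * d) ≤ d * n := Nat.mul_le_mul_left d hn
    nlinarith
  have h2 : ((almostReg d i u v).sigma fun G => rewirable G u v).card ≤
      ((almostReg d (i + 1) u v).sigma fun G => G.neighborFinset u ×ˢ G.neighborFinset v).card := by
    refine card_le_card_of_injOn (fun p => ⟨rewire p.1 p.2.1 p.2.2 u v, p.2⟩) ?_ ?_
    · rintro ⟨G, a, b⟩ hp
      obtain ⟨hG, hab⟩ := mem_sigma.mp hp
      refine mem_coe.mpr (mem_sigma.mpr ⟨rewire_mem_almostReg huv hG hab, ?_⟩)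
      simp only [rewirable, mem_filter, mem_univ, true_and] at hab
      have hu : (rewire G a b u v).Adj u a :=
        Or.inr (Or.inl ((edge_adj _ _ _ _).mpr ⟨by simp, hab.2.1.symm⟩))
      have hv : (rewire G a b u v).Adj v b :=
        Or.inr (Or.inr ((edge_adj _ _ _ _).mpr ⟨by simp, hab.2.2.2.2.1.symm⟩))
      simpa using And.intro hu hv
    · rintro ⟨G, a, b⟩ hp ⟨H, a', b'⟩ hq h
      simp only [Sigma.mk.injEq, heq_eq_eq, Prod.mk.injEq] at h
      obtain ⟨h, rfl, rfl⟩ := h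
      obtain rfl := rewire_injective (mem_sigma.mp hp).2 (mem_sigma.mp hq).2 h
      rfl
  rw [card_sigma, card_sigma] at h2
  have h3 : ∑ G ∈ almostReg d (i + 1) u v, (G.neighborFinset u ×ˢ G.neighborFinset v).card =
      (almostReg d (i + 1) u v).card * (i + 1) ^ 2 := by
    rw [sum_congr rfl (g := fun _ => (i + 1) ^ 2), sum_const, smul_eq_mul]
    intro G hG
    simp only [almostReg, mem_filter, mem_univ, true_and] at hG
    rw [card_product, card_neighborFinset_eq_degree, card_neighborFinset_eq_degree, hG.2.1,
      hG.2.2.1, sq]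
  calc (almostReg d i u v).card * (d * n)
      ≤ ∑ G ∈ almostReg d i u v, 2 * (rewirable G u v).card := by
        rw [← smul_eq_mul]; exact card_nsmul_le_sum _ _ _ h1
    _ = 2 * ∑ G ∈ almostReg d i u v, (rewirable G u v).card := by rw [mul_sum]
    _ ≤ 2 * ((almostReg d (i + 1) u v).card * (i + 1) ^ 2) := by
        rw [← h3]; exact Nat.mul_le_mul_left 2 h2
    _ = _ := by ring

open Nat in
theorem card_almostReg_zero_le [Fintype V] {d n : ℕ} (hV : Fintype.card V = n + 2) {u v : V}
    (huv : u ≠ v) (hn : 4 * d ≤ n) {j : ℕ} (hj : j ≤ d) :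
    (almostReg d 0 u v).card * (d * n) ^ j ≤ 2 ^ j * j ! ^ 2 * (almostReg d j u v).card := by
  induction j with
  | zero => simp
  | succ j ih =>
    have h1 := ih (by omega)
    have h2 := card_almostReg_succ hV huv (show j < d by omega) hn
    calc (almostReg d 0 u v).card * (d * n) ^ (j + 1)
        = (almostReg d 0 u v).card * (d * n) ^ j * (d * n) := by ring
      _ ≤ 2 ^ j * j ! ^ 2 * (almostReg d j u v).card * (d * n) := Nat.mul_le_mul_right _ h1
      _ = 2 ^ j * j ! ^ 2 * ((almostReg d j u v).card * (d * n)) := by ring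
      _ ≤ 2 ^ j * j ! ^ 2 * (2 * (j + 1) ^ 2 * (almostReg d (j + 1) u v).card) :=
        Nat.mul_le_mul_left _ h2
      _ = _ := by rw [factorial_succ]; ring

/-- The number of `d`-regular graphs with vertex set `Fin n`. -/
def regCount (n d : ℕ) : ℕ := Nat.card {G : SimpleGraph (Fin n) // IsReg G d}

theorem deg_of_iso {W : Type*} {G : SimpleGraph V} {H : SimpleGraph W} (e : G ≃g H) (x : V) :
    deg H (e x) = deg G x :=
  (Nat.card_congr (e.mapNeighborSet x)).symm

theorem isReg_simpleGraph_iff {W : Type*} (e : V ≃ W) (G : SimpleGraph V) (d : ℕ) :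
    IsReg (e.simpleGraph G) d ↔ IsReg G d := by
  have h : G ≃g e.simpleGraph G :=
    ⟨e, by intro a b; simp [Equiv.simpleGraph]⟩
  constructor
  · intro hH x
    rw [← deg_of_iso h x, hH]
  · intro hG y
    obtain ⟨x, rfl⟩ := h.surjective y
    rw [deg_of_iso h x, hG]

theorem card_isReg_eq_regCount [Fintype V] {n d : ℕ} (hV : Fintype.card V = n) :
    Nat.card {G : SimpleGraph V // IsReg G d} = regCount n d :=
  Nat.card_congr ((Fintype.equivFinOfCardEq hV).simpleGraph.subtypeEquiv fun G =>
    (isReg_simpleGraph_iff _ G d).symm)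

theorem regCount_le_card_almostReg (n d : ℕ) :
    regCount n d ≤ (almostReg d 0 (Sum.inr false : Fin n ⊕ Bool) (Sum.inr true)).card := by
  classical
  rw [regCount, Nat.card_eq_fintype_card, Fintype.card_subtype]
  refine card_le_card_of_injOn (fun G => G ⊕g (⊥ : SimpleGraph Bool)) ?_ ?_
  · intro G hG
    replace hG := (mem_filter.mp hG).2
    simp only [almostReg, coe_filter, mem_univ, true_and, Set.mem_ofPred_eq]
    refine ⟨?_, ?_, ?_, by simp⟩
    · rintro (x | b) h1 h2
      · have hN : (G ⊕g (⊥ : SimpleGraph Bool)).neighborFinset (.inl x) =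
            (G.neighborFinset x).map Function.Embedding.inl := by
          ext (y | y) <;> simp
        rw [← deg_eq_degree, deg_eq_degree, ← card_neighborFinset_eq_degree, hN, card_map, card_neighborFinset_eq_degree,
          ← deg_eq_degree, hG]
      · cases b <;> simp at h1 h2
    all_goals
      rw [← card_neighborFinset_eq_degree, card_eq_zero]
      ext (y | y) <;> simp
  · intro G _ H _ h
    ext x y
    have : (G ⊕g (⊥ : SimpleGraph Bool)).Adj (.inl x) (.inl y) ↔
        (H ⊕g (⊥ : SimpleGraph Bool)).Adj (.inl x) (.inl y) := by
      simp only at h; rw [h]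
    simpa using this

theorem card_almostReg_self_le (n d : ℕ) :
    (almostReg d d (Sum.inr false : Fin n ⊕ Bool) (Sum.inr true)).card ≤ regCount (n + 2) d := by
  classical
  rw [← card_isReg_eq_regCount (V := Fin n ⊕ Bool) (n := n + 2) (by simp),
    Nat.card_eq_fintype_card, Fintype.card_subtype]
  refine card_le_card ?_
  intro G hG
  simp only [almostReg, mem_filter, mem_univ, true_and] at hG ⊢
  intro x
  rw [deg_eq_degree]
  by_cases h1 : x = .inr false
  · rw [h1, hG.2.1]
  by_cases h2 : x = .inr true
  · rw [h2, hG.2.2.1]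
  exact hG.1 x h1 h2

open Nat in
theorem regCount_mul_le {d n : ℕ} (hn : 4 * d ≤ n) :
    regCount n d * (d * n) ^ d ≤ 2 ^ d * d ! ^ 2 * regCount (n + 2) d :=
  calc regCount n d * (d * n) ^ d
      ≤ (almostReg d 0 (Sum.inr false : Fin n ⊕ Bool) (Sum.inr true)).card * (d * n) ^ d :=
        Nat.mul_le_mul_right _ (regCount_le_card_almostReg n d)
    _ ≤ 2 ^ d * d ! ^ 2 * (almostReg d d (Sum.inr false : Fin n ⊕ Bool) (Sum.inr true)).card :=
        card_almostReg_zero_le (by simp) (by simp) hn le_rfl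
    _ ≤ _ := Nat.mul_le_mul_left _ (card_almostReg_self_le n d)

/-- A disjoint union of `m` complete graphs on `d + 1` vertices is `d`-regular. -/
theorem regCount_pos (m d : ℕ) : 0 < regCount (m * (d + 1)) d := by
  classical
  rw [← card_isReg_eq_regCount (V := Fin m × Fin (d + 1)) (by simp)]
  let G : SimpleGraph (Fin m × Fin (d + 1)) :=
    { Adj := fun p q => p.1 = q.1 ∧ p.2 ≠ q.2
      symm := ⟨fun p q h => ⟨h.1.symm, h.2.symm⟩⟩
      loopless := ⟨fun p h => h.2 rfl⟩ }
  have hG : IsReg G d := by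
    intro x
    rw [deg_eq_degree, ← card_neighborFinset_eq_degree]
    have : G.neighborFinset x = {x.1} ×ˢ (univ.erase x.2) := by
      ext y
      simp only [G, mem_neighborFinset, mem_product, mem_singleton, mem_erase, mem_univ, and_true]
      exact ⟨fun h => ⟨h.1.symm, h.2.symm⟩, fun h => ⟨h.1.symm, h.2.symm⟩⟩
    rw [this]
    simp
  have : Nonempty {G : SimpleGraph (Fin m × Fin (d + 1)) // IsReg G d} := ⟨⟨G, hG⟩⟩
  exact Nat.card_pos

end RegularGraphs

section Asymptotics

open Real

open Nat in
theorem regCount_step {n d : ℕ} (hd : 1 ≤ d) (hn : 8 * d ≤ n)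
    (h : ((n : ℝ) / (18 * d)) ^ (d * n) ≤ (regCount n d : ℝ) ^ 2) :
    (((n + 2 : ℕ) : ℝ) / (18 * d)) ^ (d * (n + 2)) ≤ (regCount (n + 2) d : ℝ) ^ 2 := by
  have hd0 : (0 : ℝ) < d := by exact_mod_cast hd
  have hn8 : (8 : ℝ) ≤ n := by
    have : 8 ≤ n := by omega
    exact_mod_cast this
  have hn0 : (0 : ℝ) < n := by linarith
  have h1 : (regCount n d : ℝ) * ((n : ℝ) / (2 * d)) ^ d ≤ regCount (n + 2) d := by
    have h2 : (regCount n d : ℝ) * (d * n) ^ d ≤ 2 ^ d * (d ! : ℝ) ^ 2 * regCount (n + 2) d := by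
      exact_mod_cast regCount_mul_le (show 4 * d ≤ n by omega)
    have h3 : (d ! : ℝ) ≤ (d : ℝ) ^ d := by exact_mod_cast Nat.factorial_le_pow d
    have h4 : (2 : ℝ) ^ d * (d ! : ℝ) ^ 2 * regCount (n + 2) d ≤
        2 ^ d * ((d : ℝ) ^ d) ^ 2 * regCount (n + 2) d := by gcongr
    have h5 : (n : ℝ) / (2 * d) = (d * n) / (2 * d ^ 2) := by field_simp
    rw [h5, div_pow, ← mul_div_assoc, div_le_iff₀ (by positivity)]
    calc _ ≤ _ := h2.trans h4
      _ = _ := by rw [mul_pow, ← pow_mul, ← pow_mul, mul_comm d 2]; ring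
  have h6 : (((n + 2 : ℕ) : ℝ) / (18 * d)) = (n : ℝ) / (18 * d) * (1 + 2 / n) := by
    push_cast; field_simp
  have h7 : (1 + 2 / (n : ℝ)) ^ (d * n) ≤ exp 1 ^ (2 * d) := by
    calc (1 + 2 / (n : ℝ)) ^ (d * n) ≤ exp (2 / n) ^ (d * n) := by
          gcongr
          linarith [add_one_le_exp (2 / (n : ℝ))]
      _ = exp 1 ^ (2 * d) := by
          rw [← exp_nat_mul, ← exp_nat_mul]
          congr 1
          push_cast
          field_simp
  have h8 : exp 1 * (((n + 2 : ℕ) : ℝ) / (18 * d)) ≤ (n : ℝ) / (2 * d) := by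
    rw [← mul_div_assoc, div_le_div_iff₀ (by positivity) (by positivity)]
    push_cast
    have : exp 1 ≤ 3 := by linarith [exp_one_lt_d9]
    have h9 : exp 1 * ((n : ℝ) + 2) ≤ n * 9 := by nlinarith
    nlinarith
  calc (((n + 2 : ℕ) : ℝ) / (18 * d)) ^ (d * (n + 2))
      = ((n : ℝ) / (18 * d)) ^ (d * n) * (1 + 2 / (n : ℝ)) ^ (d * n) *
          (((n + 2 : ℕ) : ℝ) / (18 * d)) ^ (2 * d) := by
        rw [← mul_pow, ← h6, ← pow_add]; congr 1; ring
    _ ≤ (regCount n d : ℝ) ^ 2 * exp 1 ^ (2 * d) *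
          (((n + 2 : ℕ) : ℝ) / (18 * d)) ^ (2 * d) := by gcongr
    _ = (regCount n d : ℝ) ^ 2 * (exp 1 * (((n + 2 : ℕ) : ℝ) / (18 * d))) ^ (2 * d) := by
        rw [mul_pow]; ring
    _ ≤ (regCount n d : ℝ) ^ 2 * ((n : ℝ) / (2 * d)) ^ (2 * d) := by gcongr
    _ = ((regCount n d : ℝ) * ((n : ℝ) / (2 * d)) ^ d) ^ 2 := by
        rw [mul_pow, ← pow_mul, mul_comm d 2]
    _ ≤ (regCount (n + 2) d : ℝ) ^ 2 := by gcongr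

theorem regCount_sq_ge {n d : ℕ} (hd : 1 ≤ d) (hn : 9 * (d + 1) ≤ n) (he : Even (d * n)) :
    ((n : ℝ) / (18 * d)) ^ (d * n) ≤ (regCount n d : ℝ) ^ 2 := by
  have base : ∀ m, 8 ≤ m → m ≤ 9 → ∀ j, (((m * (d + 1) + 2 * j : ℕ) : ℝ) / (18 * d)) ^
      (d * (m * (d + 1) + 2 * j)) ≤ (regCount (m * (d + 1) + 2 * j) d : ℝ) ^ 2 := by
    intro m hm hm' j
    induction j with
    | zero =>
      have h1 : (1 : ℝ) ≤ regCount (m * (d + 1)) d := by exact_mod_cast regCount_pos m d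
      have hd0 : (0 : ℝ) < d := by exact_mod_cast hd
      have h2 : ((m * (d + 1) : ℕ) : ℝ) ≤ 18 * d := by
        have : m * (d + 1) ≤ 18 * d := by nlinarith
        exact_mod_cast this
      calc _ ≤ (1 : ℝ) := by
            refine pow_le_one₀ (by positivity) ?_
            rw [div_le_one (by positivity)]
            simpa using h2
        _ ≤ _ := by simpa using one_le_pow₀ h1 (n := 2)
    | succ j ih =>
      have := regCount_step hd (by nlinarith) ih
      rw [show m * (d + 1) + 2 * (j + 1) = m * (d + 1) + 2 * j + 2 by ring]
      exact this
  rcases Nat.even_or_odd n with h | h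
  · obtain ⟨j, hj⟩ : ∃ j, n = 8 * (d + 1) + 2 * j := by
      obtain ⟨a, rfl⟩ := h
      exact ⟨a - 4 * (d + 1), by omega⟩
    have := base 8 le_rfl (by norm_num) j
    rwa [← hj] at this
  · have hde : Even d := by
      rcases Nat.even_mul.mp he with h' | h'
      · exact h'
      · exact absurd h' (Nat.not_even_iff_odd.mpr h)
    obtain ⟨j, hj⟩ : ∃ j, n = 9 * (d + 1) + 2 * j := by
      obtain ⟨a, rfl⟩ := h
      obtain ⟨b, rfl⟩ := hde
      exact ⟨a - (9 * b + 4), by omega⟩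
    have := base 9 (by norm_num) le_rfl j
    rwa [← hj] at this

theorem regCount_ge {n d r : ℕ} (hd : 1 ≤ d) (hn : 9 * (d + 1) ≤ n) (hr : d * n = 2 * r) :
    ((n : ℝ) / (18 * d)) ^ r ≤ regCount n d := by
  have h := regCount_sq_ge hd hn (hr ▸ even_two_mul r)
  rw [hr, mul_comm 2 r, pow_mul] at h
  exact (pow_le_pow_iff_left₀ (by positivity) (by positivity) two_ne_zero).mp h

theorem choose_le_exp_mul_div_pow (N j : ℕ) :
    (N.choose j : ℝ) ≤ (exp 1 * N / j) ^ j := by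
  rcases Nat.eq_zero_or_pos j with rfl | hj
  · simp
  have hj0 : (0 : ℝ) < j := by exact_mod_cast hj
  have h1 := Nat.choose_le_pow_div (α := ℝ) j N
  have h2 := pow_div_factorial_le_exp (x := (j : ℝ)) hj0.le j
  have hf : (0 : ℝ) < (j.factorial : ℝ) := by exact_mod_cast j.factorial_pos
  refine h1.trans ?_
  rw [div_pow, mul_pow, ← exp_nat_mul, mul_one, div_le_div_iff₀ hf (by positivity)]
  rw [div_le_iff₀ hf] at h2
  calc (N : ℝ) ^ j * (j : ℝ) ^ j ≤ N ^ j * (exp j * j.factorial) := by gcongr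
    _ = _ := by ring

theorem log_add_log_sub_le {d L p lW ls : ℝ}
    (hW : lW ≤ -20 + log d - log L / 2 + L / 2 - p / 2 + log 2)
    (hs : ls ≤ 2 * log 2 + lW + log L - 2 * log d + log 2) :
    lW + ls - L ≤ -36 - p := by
  have := log_two_lt_d9
  linarith

theorem entropy_exponent_le {d L p lW ls t : ℝ} (hd : 3 ≤ d) (hdL : 5 * d ≤ L)
    (hp : p * (d - 1) = L)
    (hW : -20 + log d - log L / 2 + L / 2 - p / 2 ≤ lW)
    (hW' : lW ≤ -20 + log d - log L / 2 + L / 2 - p / 2 + log 2)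
    (hs : 2 * log 2 + lW + log L - 2 * log d ≤ ls)
    (hs' : ls ≤ 2 * log 2 + lW + log L - 2 * log d + log 2)
    (ht : 0 ≤ t) (ht' : t ≤ d ^ 2 / (2 * L)) :
    (log 2 + L - ls) + t * (1 + (log 2 + L - ls - lW)) +
      d / 2 * (log 288 + 1 + (lW + ls - L)) ≤ -1 := by
  have hl2 := log_two_lt_d9
  have hL : 0 < L := by linarith
  have hp0 : 0 < p := by
    by_contra h
    push Not at h
    nlinarith
  have hlL : 0 ≤ log L := log_nonneg (by linarith)
  have hld : log d ≤ d - 1 := log_le_sub_one_of_pos (by linarith)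
  have h288 : log 288 ≤ 6.25 := by
    have h1 : log 288 ≤ log (2 ^ 9) := log_le_log (by norm_num) (by norm_num)
    rw [log_pow] at h1
    push_cast at h1
    linarith
  have h1 : t * (1 + (log 2 + L - ls - lW)) ≤ d ^ 2 / (2 * L) * (41 + p) := by
    calc t * (1 + (log 2 + L - ls - lW)) ≤ t * (41 + p) :=
          mul_le_mul_of_nonneg_left (by linarith) ht
      _ ≤ _ := by gcongr
  have h2 : d ^ 2 / (2 * L) * (41 + p) ≤ 4.85 * d := by
    rw [div_mul_eq_mul_div, div_le_iff₀ (by positivity)]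
    have e1 : d * 5 * d ≤ d * L := by nlinarith
    have e2 : d * (d * p) ≤ d * (1.5 * L) :=
      mul_le_mul_of_nonneg_left
        (by nlinarith [mul_nonneg hp0.le (show 0 ≤ d - 3 by linarith)]) (by linarith)
    nlinarith
  have h3 := log_add_log_sub_le hW' hs'
  have h4 : d / 2 * (log 288 + 1 + (lW + ls - L)) ≤ d / 2 * (-28.75 - p) := by
    gcongr
    linarith
  have h5 : d / 2 * (-28.75 - p) = -14.375 * d - L / 2 - p / 2 := by
    rw [← hp]; ring
  linarith

/-- The product of the counting bounds, in exponential form. -/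
theorem counting_bound_le {n d W s k r : ℕ} (hW : 1 ≤ W) (hd : 1 ≤ d) (hs : 1 ≤ s)
    (hk : k = n / s + 1) (hWs : W * s ≤ n) (hr : d * n = 2 * r) :
    ((k ^ n * ((k ^ 2).choose (W * k) * ((2 * s) ^ 2 * (W * k)).choose r) : ℕ) : ℝ) ≤
      exp (n * ((log 2 + log n - log s) + 2 * W / s * (1 + (log 2 + log n - log s - log W)) +
        d / 2 * (log 288 + 1 + (log W + log s - log n)))) * ((n : ℝ) / (18 * d)) ^ r := by
  have hW0 : (0 : ℝ) < W := by exact_mod_cast hW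
  have hd0 : (0 : ℝ) < d := by exact_mod_cast hd
  have hs0 : (0 : ℝ) < s := by exact_mod_cast hs
  have hWs' : (W : ℝ) * s ≤ n := by exact_mod_cast hWs
  have hn0 : (0 : ℝ) < n := lt_of_lt_of_le (by positivity) hWs'
  have hsn : (s : ℝ) ≤ n := le_trans (by nlinarith [show (1 : ℝ) ≤ W by exact_mod_cast hW]) hWs'
  have hk0 : (0 : ℝ) < k := by rw [hk]; positivity
  have hk2 : (k : ℝ) ≤ 2 * n / s := by
    have h1 : ((n / s : ℕ) : ℝ) ≤ (n : ℝ) / s := Nat.cast_div_le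
    have h2 : (1 : ℝ) ≤ n / s := by rwa [one_le_div hs0]
    rw [hk, mul_div_assoc]
    push_cast
    linarith
  have hr' : (d : ℝ) * n = 2 * r := by exact_mod_cast hr
  have hr0 : (0 : ℝ) < r := by nlinarith [mul_pos hd0 hn0]
  have hlq : log (2 * n / s) = log 2 + log n - log s := by
    rw [log_div (by positivity) (by positivity), log_mul (by positivity) (by positivity)]
  have b1 : (k : ℝ) ^ n ≤ exp (n * (log 2 + log n - log s)) := by
    rw [exp_nat_mul, ← hlq, exp_log (by positivity)]
    gcongr
  have hlog : 0 ≤ log 2 + log n - log s - log W := by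
    have h1 : log (W * s) ≤ log n := log_le_log (by positivity) hWs'
    rw [log_mul (by positivity) (by positivity)] at h1
    linarith [log_pos (show (1 : ℝ) < 2 by norm_num)]
  have b2 : ((k ^ 2).choose (W * k) : ℝ) ≤
      exp (n * (2 * W / s * (1 + (log 2 + log n - log s - log W)))) := by
    calc ((k ^ 2).choose (W * k) : ℝ)
        ≤ (exp 1 * (k ^ 2 : ℕ) / (W * k : ℕ)) ^ (W * k) := choose_le_exp_mul_div_pow _ _
      _ ≤ (exp (1 + (log 2 + log n - log s - log W))) ^ (W * k) := by
          refine pow_le_pow_left₀ (by positivity) ?_ _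
          rw [← hlq, ← log_div (by positivity) (by positivity), exp_add, exp_log (by positivity),
            mul_div_assoc]
          have hq : ((k ^ 2 : ℕ) : ℝ) / ((W * k : ℕ) : ℝ) = k / W := by
            push_cast
            field_simp
          rw [hq]
          gcongr
      _ = exp ((W * k) * (1 + (log 2 + log n - log s - log W))) := by
          rw [← exp_nat_mul]; push_cast; ring_nf
      _ ≤ exp ((W * (2 * n / s)) * (1 + (log 2 + log n - log s - log W))) := by gcongr
      _ = _ := by congr 1; ring
  have b3 : (((2 * s) ^ 2 * (W * k)).choose r : ℝ) ≤
      exp (n * (d / 2 * (log 288 + 1 + (log W + log s - log n)))) *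
        ((n : ℝ) / (18 * d)) ^ r := by
    have e1 : log 288 + 1 + (log W + log s - log n) = log (288 * exp 1 * (W * s / n)) := by
      rw [log_mul (by positivity) (by positivity), log_mul (by positivity) (by positivity),
        log_exp, log_div (by positivity) (by positivity), log_mul (by positivity) (by positivity)]
    have e2 : (n : ℝ) * (d / 2 * (log 288 + 1 + (log W + log s - log n))) =
        r * log (288 * exp 1 * (W * s / n)) := by
      rw [← e1]; linear_combination (log 288 + 1 + (log W + log s - log n)) / 2 * hr'
    rw [e2, exp_nat_mul, exp_log (by positivity), ← mul_pow]
    refine (choose_le_exp_mul_div_pow _ _).trans (pow_le_pow_left₀ (by positivity) ?_ _)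
    push_cast
    have hr2 : (r : ℝ) = d * n / 2 := by linarith
    calc exp 1 * ((2 * (s : ℝ)) ^ 2 * (W * k)) / r
        ≤ exp 1 * ((2 * (s : ℝ)) ^ 2 * (W * (2 * n / s))) / r := by gcongr
      _ = _ := by rw [hr2]; field_simp; ring
  push_cast
  rw [mul_add (n : ℝ), mul_add (n : ℝ), exp_add, exp_add]
  calc _ ≤ exp (n * (log 2 + log n - log s)) *
        (exp (n * (2 * W / s * (1 + (log 2 + log n - log s - log W)))) *
        (exp (n * (d / 2 * (log 288 + 1 + (log W + log s - log n)))) *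
        ((n : ℝ) / (18 * d)) ^ r)) := by gcongr
    _ = _ := by ring

/-- The proportion of `d`-regular graphs of small sparse twin-width is exponentially small. -/
theorem card_isReg_stww_lt_le {n d : ℕ} (hL : 300 ≤ log n) (hd : 2 < d)
    (hdL : (d : ℝ) < log n / 5) (he : Even (d * n)) :
    (Nat.card {G : SimpleGraph (Fin n) // IsReg G d ∧
        (stww G : ℝ) < exp (-20) * ((d : ℝ) / √(log n)) *
          (n : ℝ) ^ (((d : ℝ) - 2) / (2 * (d : ℝ) - 2))} : ℝ)
      ≤ exp (-n) * regCount n d := by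
  obtain ⟨r, hr⟩ := he
  rw [← two_mul] at hr
  set L := log n with hLdef
  set Y : ℝ := exp (-20) * ((d : ℝ) / √L) * (n : ℝ) ^ (((d : ℝ) - 2) / (2 * (d : ℝ) - 2)) with hY
  have hL0 : 0 < L := by linarith
  have hd3 : (3 : ℝ) ≤ d := by exact_mod_cast hd
  have hn0 : (0 : ℝ) < n := by
    rcases Nat.eq_zero_or_pos n with h | h
    · rw [hLdef, h] at hL0
      simp at hL0
    · exact_mod_cast h
  set p : ℝ := L / (d - 1) with hp
  have hpd : p * (d - 1) = L := div_mul_cancel₀ _ (by linarith)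
  have hpL : p ≤ L / 2 := by
    rw [hp]
    gcongr
    linarith
  have hY0 : 0 < Y := by positivity
  have hlY : log Y = -20 + log d - log L / 2 + L / 2 - p / 2 := by
    rw [hY, log_mul (by positivity) (by positivity), log_mul (by positivity) (by positivity),
      log_exp, log_div (by positivity) (by positivity), log_sqrt hL0.le, log_rpow hn0, ← hLdef]
    have : ((d : ℝ) - 2) / (2 * d - 2) * L = L / 2 - p / 2 := by
      have h1 : (d : ℝ) - 1 ≠ 0 := by linarith
      rw [hp, show (2 * (d : ℝ) - 2) = 2 * (d - 1) by ring]
      field_simp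
      ring
    rw [this]
    ring
  have hld0 : 0 ≤ log (d : ℝ) := log_nonneg (by linarith)
  have hlL : log L ≤ 14 + L / 16 := by
    have h1 : log L = log 16 + log (L / 16) := by
      rw [← log_mul (by norm_num) (by positivity)]; congr 1; ring
    have h2 := log_le_sub_one_of_pos (show (0 : ℝ) < 16 by norm_num)
    have h3 := log_le_sub_one_of_pos (show 0 < L / 16 by positivity)
    linarith
  have hLY : L ≤ Y := by
    rw [← log_le_log_iff hL0 hY0, hlY]
    linarith
  set w := ⌊Y⌋₊ with hw
  have hWY : Y ≤ ((w + 1 : ℕ) : ℝ) := by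
    push_cast
    exact (Nat.lt_floor_add_one Y).le
  have hWY' : ((w + 1 : ℕ) : ℝ) ≤ 2 * Y := by
    push_cast
    linarith [Nat.floor_le hY0.le]
  set W := w + 1 with hWdef
  have hW0 : (0 : ℝ) < W := hY0.trans_le hWY
  set x : ℝ := 4 * W * L / d ^ 2 with hx
  have hx0 : 0 < x := by positivity
  have hx2 : 2 ≤ x := by
    rw [hx, le_div_iff₀ (by positivity)]
    nlinarith
  set s := ⌈x⌉₊ with hs
  have hxs : x ≤ s := Nat.le_ceil x
  have hsx : (s : ℝ) ≤ 2 * x := by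
    linarith [(Nat.ceil_lt_add_one hx0.le).le]
  have hs0 : (0 : ℝ) < s := hx0.trans_le hxs
  have hs2 : 2 ≤ s := by exact_mod_cast hx2.trans hxs
  have hlx : log x = 2 * log 2 + log W + log L - 2 * log d := by
    rw [hx, log_div (by positivity) (by positivity), log_mul (by positivity) (by positivity),
      log_mul (by positivity) (by positivity), log_pow,
      show (4 : ℝ) = 2 ^ 2 by norm_num, log_pow]
    push_cast
    ring
  have hlW : -20 + log d - log L / 2 + L / 2 - p / 2 ≤ log W := by
    rw [← hlY]; exact log_le_log hY0 hWY
  have hlW' : log W ≤ -20 + log d - log L / 2 + L / 2 - p / 2 + log 2 := by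
    rw [← hlY, add_comm, ← log_mul (by norm_num) hY0.ne']
    exact log_le_log hW0 hWY'
  have hls : 2 * log 2 + log W + log L - 2 * log d ≤ log s := by
    rw [← hlx]; exact log_le_log hx0 hxs
  have hls' : log s ≤ 2 * log 2 + log W + log L - 2 * log d + log 2 := by
    rw [← hlx, add_comm, ← log_mul (by norm_num) hx0.ne']
    exact log_le_log hs0 hsx
  have hWs : W * s ≤ n := by
    have h1 := log_add_log_sub_le hlW' hls'
    have h2 : log (W * s) ≤ log n := by
      rw [log_mul hW0.ne' hs0.ne', ← hLdef]
      have : 0 ≤ p := div_nonneg hL0.le (by linarith)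
      linarith
    have h3 := (log_le_log_iff (by positivity) hn0).mp h2
    exact_mod_cast h3
  have hWk : w + 1 ≤ n / s + 1 := by
    have := (Nat.le_div_iff_mul_le (by omega : 0 < s)).mpr hWs
    omega
  have ht : 2 * (W : ℝ) / s ≤ d ^ 2 / (2 * L) := by
    rw [div_le_div_iff₀ hs0 (by positivity)]
    rw [hx, div_le_iff₀ (by positivity)] at hxs
    linarith
  have hexp := entropy_exponent_le (t := 2 * (W : ℝ) / s) hd3 (by linarith) hpd hlW hlW' hls hls'
    (by positivity) ht
  have hn9 : 9 * (d + 1) ≤ n := by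
    have h1 := quadratic_le_exp_of_nonneg hL0.le
    rw [hLdef, exp_log hn0, ← hLdef] at h1
    have h2 : 9 * ((d : ℝ) + 1) ≤ n := by nlinarith
    exact_mod_cast h2
  have hsub : Nat.card {G : SimpleGraph (Fin n) // IsReg G d ∧ (stww G : ℝ) < Y} ≤
      Nat.card {G : SimpleGraph (Fin n) // IsReg G d ∧ stww G ≤ w} :=
    Nat.card_le_card_of_injective
      (fun G => ⟨G.1, G.2.1, Nat.le_floor G.2.2.le⟩)
      (fun G H h => Subtype.ext (Subtype.mk.inj h))
  have hcard := hsub.trans (card_isReg_stww_le hs2 rfl hWk hr)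
  have hcount := counting_bound_le (n := n) (d := d) (W := W) (s := s) (by omega) (by omega)
    (by omega) rfl hWs hr
  refine ((Nat.cast_le (α := ℝ)).mpr hcard).trans (hcount.trans ?_)
  refine mul_le_mul (exp_le_exp.mpr ?_) (regCount_ge (by omega) hn9 hr) (by positivity)
    (exp_pos _).le
  rw [← hLdef]
  linarith [mul_le_mul_of_nonneg_left hexp hn0.le]

end Asymptotics

theorem statement_14 :
    ∃ ε : ℝ, 0 < ε ∧ ∀ δ : ℝ, 0 < δ → ∃ N : ℕ, ∀ n : ℕ, N ≤ n →
    ∀ d : ℕ, 2 < d → (d : ℝ) < Real.log n / 5 → Even (d * n) →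
    (Nat.card {G : SimpleGraph (Fin n) // IsReg G d ∧
        (stww G : ℝ) < ε * ((d : ℝ) / Real.sqrt (Real.log n)) *
          (n : ℝ) ^ (((d : ℝ) - 2) / (2 * (d : ℝ) - 2))} : ℝ)
      ≤ δ * Nat.card {G : SimpleGraph (Fin n) // IsReg G d} := by
  refine ⟨Real.exp (-20), Real.exp_pos _, fun δ hδ =>
    ⟨max ⌈Real.exp 300⌉₊ ⌈-Real.log δ⌉₊, fun n hn d hd hdL he => ?_⟩⟩
  have h1 : Real.exp 300 ≤ n :=
    (Nat.le_ceil _).trans (by exact_mod_cast (le_max_left _ _).trans hn)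
  have h2 : -Real.log δ ≤ n :=
    (Nat.le_ceil _).trans (by exact_mod_cast (le_max_right _ _).trans hn)
  have hL : 300 ≤ Real.log n :=
    (Real.le_log_iff_exp_le ((Real.exp_pos _).trans_le h1)).mpr h1
  refine (card_isReg_stww_lt_le hL hd hdL he).trans (mul_le_mul_of_nonneg_right ?_ (by positivity))
  rw [← Real.le_log_iff_exp_le hδ]
  linarith

end TwwPaper
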